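/- Suppose q ≥ 2 and f_1, …, f_m : F → F are the evaluation maps of polynomials p_1, …, p_m ∈ F[X], each of degree strictly less than q - 1. Then the vector v ∈ F^(F×F) defined by v_(α,β) = β satisfies v ∈ Ker(A) and v ∉ K; consequently Ker(A) strictly contains K. -/

import Mathlib

/-- The subspace `K`. -/
def Kset (F : Type*) [Field F] [Fintype F] : Set ((F × F) → F) :=
  {v | ∃ w : F → F, (∀ α β : F, v (α, β) = w α) ∧ ∑ α : F, w α = 0}

/-- The matrix `A` with `A i (α,β) = 1` iff `f i α = β`. -/
def Amat {F : Type*} [Field F] [DecidableEq F] {m : ℕ} (f : Fin m → F → F) :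
    Matrix (Fin m) (F × F) F :=
  Matrix.of fun i p => if f i p.1 = p.2 then 1 else 0

/-- The kernel of `A`. -/
def kerSet {F : Type*} [Field F] [Fintype F] [DecidableEq F] {m : ℕ}
    (f : Fin m → F → F) : Set ((F × F) → F) :=
  {v | ∀ i, ∑ p : F × F, Amat f i p * v p = 0}

/-- Over a finite field with `q` elements, the values of a polynomial of degree less than `q - 1`
sum to zero. -/
theorem Polynomial.sum_eval_eq_zero_of_degree_lt {F : Type*} [Field F] [Fintype F]
    (p : Polynomial F) (hp : p.degree < ((Fintype.card F - 1 : ℕ) : WithBot ℕ)) :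
    ∑ x : F, p.eval x = 0 := by
  classical
  simp_rw [Polynomial.eval_eq_sum, Polynomial.sum_def]
  rw [Finset.sum_comm]
  refine Finset.sum_eq_zero fun n hn => ?_
  rw [← Finset.mul_sum, FiniteField.sum_pow_lt_card_sub_one F n, mul_zero]
  exact_mod_cast (Polynomial.le_degree_of_mem_supp n hn).trans_lt hp

/-- Each row of `Amat f` sums a vector over the graph of the corresponding function. -/
theorem sum_Amat_mul {F : Type*} [Field F] [Fintype F] [DecidableEq F] {m : ℕ}
    (f : Fin m → F → F) (i : Fin m) (v : F × F → F) :
    ∑ p : F × F, Amat f i p * v p = ∑ α : F, v (α, f i α) := by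
  simp [Fintype.sum_prod_type, Amat]

theorem Kset_subset_kerSet {F : Type*} [Field F] [Fintype F] [DecidableEq F] {m : ℕ}
    (f : Fin m → F → F) : Kset F ⊆ kerSet f := by
  rintro v ⟨w, hw, hsum⟩ i
  rw [sum_Amat_mul]
  simpa only [hw] using hsum

theorem snd_notMem_Kset (F : Type*) [Field F] [Fintype F] :
    (fun p : F × F => p.2) ∉ Kset F := by
  rintro ⟨w, hw, -⟩
  exact zero_ne_one ((hw 0 0).trans (hw 0 1).symm)

/-- Suppose `q ≥ 2` and `f_1, …, f_m` are the evaluation maps of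
polynomials `p_1, …, p_m ∈ F[X]` of degree strictly less than `q - 1`. Then the vector
`v (α,β) = β` satisfies `v ∈ Ker(A)` and `v ∉ K`; consequently `Ker(A) ⊋ K`. -/
theorem kernel_strictly_contains_K_of_polynomials
    (F : Type*) [Field F] [Fintype F] [DecidableEq F]
    (q : ℕ) (hq : q = Fintype.card F) (hq2 : 2 ≤ q)
    (m : ℕ) (ps : Fin m → Polynomial F)
    (hdeg : ∀ i, (ps i).degree < ((q - 1 : ℕ) : WithBot ℕ))
    (f : Fin m → F → F) (hf : ∀ i x, f i x = (ps i).eval x) :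
    (fun p : F × F => p.2) ∈ kerSet f ∧
    (fun p : F × F => p.2) ∉ Kset F ∧
    Kset F ⊂ kerSet f := by
  subst hq
  have hker : (fun p : F × F => p.2) ∈ kerSet f := fun i => by
    rw [sum_Amat_mul]
    simpa only [hf] using (ps i).sum_eval_eq_zero_of_degree_lt (hdeg i)
  exact ⟨hker, snd_notMem_Kset F, (Set.ssubset_iff_of_subset (Kset_subset_kerSet f)).2
    ⟨_, hker, snd_notMem_Kset F⟩⟩
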